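/- Assume in addition that v(x) = ∞ only for x = 0, that R is complete for the topology defined by v (every v-Cauchy sequence converges), and that R has the valuation-ring divisibility property: for all x, y ∈ R with v(x) ≥ v(y) there exists z ∈ R with x = y·z. Let n, N, d ≥ 1 be integers, ϖ ∈ R with 0 < v(ϖ) < ∞, and set b = N·v(ϖ)/(p−1) and a = p·N·v(ϖ)/(p−1). Let A, B ∈ M_d(W_n(R)) be matrices with A·B = [ϖ]^N·I_d. Let X be a row vector in W_n(R)^d such that every entry of φ(X) − X·A lies in [𝔞_R^{>a}] (where φ is applied entrywise). Then there exists a row vector Y ∈ W_n(R)^d, all of whose entries lie in [𝔞_R^{>b}], such that φ(X + Y) = (X + Y)·A. (This is the surjectivity part of Proposition 2.1 of the paper for free Kisin modules: every φ-morphism 𝔐 → W_n(R)/[𝔞_R^{>a}] lifts, modulo [𝔞_R^{>b}], to a φ-morphism 𝔐 → W_n(R).) -/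

import Mathlib

/-!
Statement 1 (surjectivity part of Proposition 2.7 of Caruso–Liu, for free Kisin
modules).  With `R` perfect of characteristic `p`, complete for its valuation `v`,
with the divisibility property of a valuation ring, `A·B = [ϖ]^N·I_d` in
`M_d(W_n(R))`, and `X` a row vector with `φ(X) − X·A ≡ 0` modulo `[𝔞_R^{>a}]`
(`a = pN v(ϖ)/(p−1)`), there is a row vector `Y` with entries in `[𝔞_R^{>b}]`
(`b = N v(ϖ)/(p−1)`) such that `φ(X+Y) = (X+Y)·A`.
-/

/-- The Teichmüller representative of `y` in the truncated Witt vector ring `W_n(R)`. -/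
noncomputable def truncTeichmuller (p n : ℕ) [hp : Fact p.Prime] {R : Type*} [CommRing R]
    (y : R) : TruncatedWittVector p n R :=
  WittVector.truncate n (WittVector.teichmuller p y)

/-- The Frobenius of `W_n(R)` for `R` of characteristic `p`, given on components by
`(x_0, …, x_{n-1}) ↦ (x_0^p, …, x_{n-1}^p)`. -/
def truncFrobenius (p n : ℕ) {R : Type*} [CommRing R] (x : TruncatedWittVector p n R) :
    TruncatedWittVector p n R :=
  TruncatedWittVector.mk p fun i => x.coeff i ^ p

/-- The ideal `[𝔞_R^{>c}]` of `W_n(R)`: generated by Teichmüller representatives of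
elements of valuation `> c`. -/
noncomputable def idealGT (p n : ℕ) [hp : Fact p.Prime] {R : Type*} [CommRing R]
    (v : R → WithTop ℝ) (c : ℝ) : Ideal (TruncatedWittVector p n R) :=
  Ideal.span {z | ∃ y : R, (c : WithTop ℝ) < v y ∧ z = truncTeichmuller p n y}

section Aux

variable {R : Type*} [CommRing R]

theorem aux_le_mul_right {v : R → WithTop ℝ} (hvmul : ∀ x y : R, v (x * y) = v x + v y)
    (hvnonneg : ∀ x : R, 0 ≤ v x) {c : WithTop ℝ} {x : R} (h : c ≤ v x) (y : R) :
    c ≤ v (x * y) := by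
  rw [hvmul]
  calc c = c + 0 := (add_zero c).symm
    _ ≤ v x + v y := add_le_add h (hvnonneg y)

theorem aux_le_neg {v : R → WithTop ℝ} (hvmul : ∀ x y : R, v (x * y) = v x + v y)
    (hvnonneg : ∀ x : R, 0 ≤ v x) {c : WithTop ℝ} {x : R} (h : c ≤ v x) :
    c ≤ v (-x) := by
  have := aux_le_mul_right hvmul hvnonneg h (-1)
  simpa using this

theorem aux_le_pow {v : R → WithTop ℝ} (hvmul : ∀ x y : R, v (x * y) = v x + v y)
    (hvnonneg : ∀ x : R, 0 ≤ v x) {c : WithTop ℝ} {x : R} (h : c ≤ v x) {k : ℕ} (hk : k ≠ 0) :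
    c ≤ v (x ^ k) := by
  obtain ⟨m, rfl⟩ := Nat.exists_eq_succ_of_ne_zero hk
  rw [pow_succ']
  exact aux_le_mul_right hvmul hvnonneg h _

theorem aux_le_add {v : R → WithTop ℝ} (hvadd : ∀ x y : R, min (v x) (v y) ≤ v (x + y))
    {c : WithTop ℝ} {x y : R} (hx : c ≤ v x) (hy : c ≤ v y) : c ≤ v (x + y) :=
  (le_min hx hy).trans (hvadd x y)

theorem aux_le_sum {v : R → WithTop ℝ} (hv0 : v 0 = ⊤)
    (hvadd : ∀ x y : R, min (v x) (v y) ≤ v (x + y))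
    {c : WithTop ℝ} {ι : Type*} (s : Finset ι) (f : ι → R) (h : ∀ j, c ≤ v (f j)) :
    c ≤ v (∑ j ∈ s, f j) := by
  classical
  induction s using Finset.induction_on with
  | empty => simp [hv0]
  | insert a s ha ih =>
    rw [Finset.sum_insert ha]
    exact aux_le_add hvadd (h a) ih

/-- The residual equation, solved by successive approximation. -/
theorem aux_residue (p : ℕ) [hp : Fact p.Prime] [CharP R p]
    (v : R → WithTop ℝ)
    (hv0 : v 0 = ⊤)
    (hvmul : ∀ x y : R, v (x * y) = v x + v y)
    (hvadd : ∀ x y : R, min (v x) (v y) ≤ v (x + y))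
    (hvnonneg : ∀ x : R, 0 ≤ v x)
    (hvtop : ∀ x : R, v x = ⊤ → x = 0)
    (hcomplete : ∀ u : ℕ → R,
      (∀ c : ℝ, ∃ K : ℕ, ∀ i ≥ K, ∀ j ≥ K, (c : WithTop ℝ) < v (u i - u j)) →
      ∃ L : R, ∀ c : ℝ, ∃ K : ℕ, ∀ i ≥ K, (c : WithTop ℝ) < v (u i - L))
    {d : ℕ} (r : R) (ρ : ℝ) (hρ : 0 < ρ) (hr : (ρ : WithTop ℝ) ≤ v r)
    (B : Fin d → Fin d → R) (C : Fin d → R) :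
    ∃ u : Fin d → R, ∀ i, u i = r * ∑ j, u j ^ p * B j i + C i := by
  have hp0 : p ≠ 0 := hp.out.ne_zero
  let F : (Fin d → R) → (Fin d → R) := fun u i => r * ∑ j, u j ^ p * B j i + C i
  have hF : ∀ (x y : Fin d → R) (i), F x i - F y i = r * ∑ j, (x j - y j) ^ p * B j i := by
    intro x y i
    simp only [F, sub_pow_char, sub_mul, Finset.sum_sub_distrib]
    ring
  have hFv : ∀ (x y : Fin d → R) (c : ℝ), (∀ i, (c : WithTop ℝ) ≤ v (x i - y i)) →
      ∀ i, ((ρ + c : ℝ) : WithTop ℝ) ≤ v (F x i - F y i) := by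
    intro x y c h i
    rw [hF, hvmul, WithTop.coe_add]
    refine add_le_add hr (aux_le_sum hv0 hvadd _ _ fun j => ?_)
    exact aux_le_mul_right hvmul hvnonneg (aux_le_pow hvmul hvnonneg (h j) hp0) _
  let u : ℕ → Fin d → R := fun k => F^[k] 0
  have hu : ∀ k, u (k + 1) = F (u k) := fun k => Function.iterate_succ_apply' F k 0
  have hstep : ∀ (k : ℕ) i, ((k * ρ : ℝ) : WithTop ℝ) ≤ v (u (k + 1) i - u k i) := by
    intro k
    induction k with
    | zero => intro i; simpa using hvnonneg _
    | succ k ih =>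
      intro i
      have := hFv _ _ _ ih i
      rw [← hu, ← hu] at this
      convert this using 2
      push_cast; ring
  have hK : ∀ (K m : ℕ) i, ((K * ρ : ℝ) : WithTop ℝ) ≤ v (u (K + m) i - u K i) := by
    intro K m i
    induction m with
    | zero => simp [hv0]
    | succ m ih =>
      have h1 : u (K + (m + 1)) i - u K i
          = (u (K + m + 1) i - u (K + m) i) + (u (K + m) i - u K i) := by
        rw [← add_assoc]; ring
      rw [h1]
      refine aux_le_add hvadd (le_trans ?_ (hstep (K + m) i)) ih
      rw [WithTop.coe_le_coe]
      push_cast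
      have : (0 : ℝ) ≤ m := Nat.cast_nonneg m
      nlinarith
  have hlim : ∀ i, ∃ L : R, ∀ c : ℝ, ∃ K : ℕ, ∀ k ≥ K, (c : WithTop ℝ) < v (u k i - L) := by
    intro i
    apply hcomplete (fun k => u k i)
    intro c
    obtain ⟨K, hKc⟩ := exists_nat_gt (c / ρ)
    have hc : (c : WithTop ℝ) < ((K * ρ : ℝ) : WithTop ℝ) := by
      rw [WithTop.coe_lt_coe]; exact (div_lt_iff₀ hρ).1 hKc
    refine ⟨K, fun k hk l hl => lt_of_lt_of_le hc ?_⟩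
    obtain ⟨m, rfl⟩ := Nat.exists_eq_add_of_le hk
    obtain ⟨m', rfl⟩ := Nat.exists_eq_add_of_le hl
    have := aux_le_add hvadd (hK K m i) (aux_le_neg hvmul hvnonneg (hK K m' i))
    convert this using 2
    ring
  choose L hL using hlim
  refine ⟨L, fun i => ?_⟩
  change L i = F L i
  rw [← sub_eq_zero]
  apply hvtop
  by_contra hne
  obtain ⟨c, hc⟩ := WithTop.ne_top_iff_exists.1 hne
  have hcommon : ∃ K : ℕ, ∀ k ≥ K, ∀ j, (max c 0 : ℝ) < v (u k j - L j) := by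
    choose K hKj using fun j => hL j (max c 0)
    refine ⟨Finset.univ.sup K, fun k hk j => hKj j k (le_trans ?_ hk)⟩
    exact Finset.le_sup (Finset.mem_univ j)
  obtain ⟨K, hKK⟩ := hcommon
  have h1 : ((ρ + max c 0 : ℝ) : WithTop ℝ) ≤ v (F (u K) i - F L i) :=
    hFv _ _ _ (fun j => (hKK K le_rfl j).le) i
  rw [← hu] at h1
  have h2 := hKK (K + 1) (Nat.le_succ K) i
  have h3 : L i - F L i = (u (K + 1) i - F L i) + -(u (K + 1) i - L i) := by ring
  have h4 : (c : WithTop ℝ) < v (u (K + 1) i - F L i) := by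
    refine lt_of_lt_of_le ?_ h1
    rw [WithTop.coe_lt_coe]
    have := le_max_left c 0
    linarith
  have h5 : (c : WithTop ℝ) < v (-(u (K + 1) i - L i)) := by
    have := aux_le_neg hvmul hvnonneg (le_refl (v (u (K + 1) i - L i)))
    refine lt_of_lt_of_le (lt_of_le_of_lt ?_ h2) this
    rw [WithTop.coe_le_coe]
    exact le_max_left c 0
  have h6 := lt_of_lt_of_le (lt_min h4 h5) (hvadd _ _)
  rw [← h3, ← hc] at h6
  exact lt_irrefl _ h6

open WittVector in
/-- Solving modulo `p ^ n` in `W(R)`. -/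
theorem aux_witt (p : ℕ) [hp : Fact p.Prime] [CharP R p] [PerfectRing R p] {d : ℕ} (r : R)
    (hres : ∀ (B : Fin d → Fin d → R) (C : Fin d → R),
      ∃ u : Fin d → R, ∀ i, u i = r * ∑ j, u j ^ p * B j i + C i)
    (B : Fin d → Fin d → WittVector p R) (C : Fin d → WittVector p R) (n : ℕ) :
    ∃ Z : Fin d → WittVector p R, ∀ i, (p : WittVector p R) ^ n ∣
      Z i - (teichmuller p r * ∑ j, frobenius (Z j) * B j i + C i) := by
  induction n with
  | zero => exact ⟨0, fun i => by simp⟩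
  | succ n ih =>
    obtain ⟨Z, hZ⟩ := ih
    choose D hD using hZ
    obtain ⟨u, hu⟩ := hres (fun j i => constantCoeff (B j i)) (fun i => - constantCoeff (D i))
    refine ⟨fun i => Z i + p ^ n * teichmuller p (u i), fun i => ?_⟩
    have h1 : (p : WittVector p R) ∣ teichmuller p (u i)
        - teichmuller p r * ∑ j, frobenius (teichmuller p (u j)) * B j i + D i := by
      rw [← Ideal.mem_span_singleton, ← ker_constantCoeff, RingHom.mem_ker]
      have hf : ∀ x : R, constantCoeff (frobenius (teichmuller p x)) = x ^ p := by
        intro x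
        change (frobenius (teichmuller p x)).coeff 0 = _
        rw [coeff_frobenius_charP, teichmuller_coeff_zero]
      have ht : ∀ x : R, constantCoeff (teichmuller p x) = x := teichmuller_coeff_zero p
      rw [map_add, map_sub, map_mul, map_sum]
      simp only [map_mul, hf, ht]
      linear_combination hu i
    obtain ⟨G, hG⟩ := h1
    refine ⟨G, ?_⟩
    simp only [map_add, map_mul, map_pow, map_natCast, add_mul, Finset.sum_add_distrib]
    have h2 : ∑ j, (p : WittVector p R) ^ n * frobenius (teichmuller p (u j)) * B j i
        = p ^ n * ∑ j, frobenius (teichmuller p (u j)) * B j i := by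
      rw [Finset.mul_sum]
      exact Finset.sum_congr rfl fun j _ => by ring
    rw [h2]
    linear_combination hD i + (p : WittVector p R) ^ n * hG

theorem aux_truncFrob (p n : ℕ) [hp : Fact p.Prime] [CharP R p] (x : WittVector p R) :
    truncFrobenius p n (WittVector.truncate n x)
      = WittVector.truncate n (WittVector.frobenius x) := by
  ext i
  simp [truncFrobenius, WittVector.coeff_frobenius_charP]

theorem aux_truncFrob_add (p n : ℕ) [hp : Fact p.Prime] [CharP R p]
    (x y : TruncatedWittVector p n R) :
    truncFrobenius p n (x + y) = truncFrobenius p n x + truncFrobenius p n y := by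
  obtain ⟨x, rfl⟩ := WittVector.truncate_surjective p n R x
  obtain ⟨y, rfl⟩ := WittVector.truncate_surjective p n R y
  simp only [← map_add, aux_truncFrob]

theorem aux_truncFrob_mul (p n : ℕ) [hp : Fact p.Prime] [CharP R p]
    (x y : TruncatedWittVector p n R) :
    truncFrobenius p n (x * y) = truncFrobenius p n x * truncFrobenius p n y := by
  obtain ⟨x, rfl⟩ := WittVector.truncate_surjective p n R x
  obtain ⟨y, rfl⟩ := WittVector.truncate_surjective p n R y
  simp only [← map_mul, aux_truncFrob]

theorem aux_teich_mul (p n : ℕ) [hp : Fact p.Prime] (x y : R) :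
    truncTeichmuller p n (x * y) = truncTeichmuller p n x * truncTeichmuller p n y := by
  simp [truncTeichmuller]

theorem aux_teich_pow (p n : ℕ) [hp : Fact p.Prime] (x : R) (k : ℕ) :
    truncTeichmuller p n (x ^ k) = truncTeichmuller p n x ^ k := by
  simp [truncTeichmuller]

theorem aux_truncFrob_teich (p n : ℕ) [hp : Fact p.Prime] [CharP R p] (x : R) :
    truncFrobenius p n (truncTeichmuller p n x) = truncTeichmuller p n (x ^ p) := by
  rw [truncTeichmuller, aux_truncFrob, truncTeichmuller, WittVector.frobenius_eq_map_frobenius,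
    WittVector.map_teichmuller, frobenius_def]

theorem aux_trunc_eq_zero (p n : ℕ) [hp : Fact p.Prime] [CharP R p] [PerfectRing R p]
    (x : WittVector p R) :
    WittVector.truncate n x = 0 ↔ (p : WittVector p R) ^ n ∣ x := by
  rw [← RingHom.mem_ker, WittVector.mem_ker_truncate, ← Ideal.mem_span_singleton,
    WittVector.mem_span_p_pow_iff_le_coeff_eq_zero]

/-- Solving in `W_n(R)`. -/
theorem aux_solve (p n : ℕ) [hp : Fact p.Prime] [CharP R p] [PerfectRing R p] {d : ℕ} (r : R)
    (hres : ∀ (B : Fin d → Fin d → R) (C : Fin d → R),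
      ∃ u : Fin d → R, ∀ i, u i = r * ∑ j, u j ^ p * B j i + C i)
    (B : Matrix (Fin d) (Fin d) (TruncatedWittVector p n R))
    (C : Fin d → TruncatedWittVector p n R) :
    ∃ Z : Fin d → TruncatedWittVector p n R,
      Z = truncTeichmuller p n r • Matrix.vecMul (fun j => truncFrobenius p n (Z j)) B + C := by
  choose B' hB' using fun j i => WittVector.truncate_surjective p n R (B j i)
  choose C' hC' using fun i => WittVector.truncate_surjective p n R (C i)
  obtain ⟨Z, hZ⟩ := aux_witt p r hres B' C' n
  refine ⟨fun i => WittVector.truncate n (Z i), funext fun i => ?_⟩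
  have h := (aux_trunc_eq_zero p n _).2 (hZ i)
  rw [map_sub, sub_eq_zero] at h
  rw [h]
  simp [Matrix.vecMul, dotProduct, aux_truncFrob, hB', hC', truncTeichmuller]

/-- Teichmüller representatives of nonzero elements are cancellable. -/
theorem aux_cancel (p n : ℕ) [hp : Fact p.Prime] [CharP R p] [PerfectRing R p] [IsDomain R]
    (t : R) (ht : t ≠ 0) (x : TruncatedWittVector p n R)
    (h : truncTeichmuller p n t * x = 0) : x = 0 := by
  obtain ⟨x, rfl⟩ := WittVector.truncate_surjective p n R x
  rw [truncTeichmuller, ← map_mul] at h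
  rw [aux_trunc_eq_zero] at h ⊢
  induction n generalizing x with
  | zero => simp
  | succ n ih =>
    have h0 : (p : WittVector p R) ∣ x := by
      have h1 : (p : WittVector p R) ∣ WittVector.teichmuller p t * x :=
        (dvd_pow_self _ n.succ_ne_zero).trans h
      rw [← Ideal.mem_span_singleton, ← WittVector.ker_constantCoeff, RingHom.mem_ker] at h1 ⊢
      rw [map_mul] at h1
      exact (mul_eq_zero.1 h1).resolve_left
        (by rw [show WittVector.constantCoeff (WittVector.teichmuller p t) = t from
          WittVector.teichmuller_coeff_zero p t]; exact ht)
    obtain ⟨y, rfl⟩ := h0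
    rw [pow_succ'] at h ⊢
    rw [mul_left_comm] at h
    have hpz : (p : WittVector p R) ≠ 0 := WittVector.p_nonzero p R
    exact mul_dvd_mul_left _ (ih y ((mul_dvd_mul_iff_left hpz).1 h))

theorem aux_idealGT (p n : ℕ) [hp : Fact p.Prime]
    (v : R → WithTop ℝ) (hv0 : v 0 = ⊤)
    (hdvd : ∀ x y : R, v y ≤ v x → ∃ z : R, x = y * z) (c : ℝ)
    {z : TruncatedWittVector p n R} (hz : z ∈ idealGT p n v c) :
    ∃ t : R, (c : WithTop ℝ) < v t ∧ truncTeichmuller p n t ∣ z := by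
  induction hz using Submodule.span_induction with
  | mem x hx => obtain ⟨y, hy, rfl⟩ := hx; exact ⟨y, hy, dvd_rfl⟩
  | zero => exact ⟨0, by simp [hv0], dvd_zero _⟩
  | smul a x _ ih => obtain ⟨t, ht, h⟩ := ih; exact ⟨t, ht, h.mul_left a⟩
  | add x y _ _ ihx ihy =>
    obtain ⟨t, ht, h⟩ := ihx
    obtain ⟨s, hs, h'⟩ := ihy
    rcases le_total (v t) (v s) with hle | hle
    · obtain ⟨q, rfl⟩ := hdvd _ _ hle
      rw [aux_teich_mul] at h'
      exact ⟨t, ht, dvd_add h ((dvd_mul_right _ _).trans h')⟩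
    · obtain ⟨q, rfl⟩ := hdvd _ _ hle
      rw [aux_teich_mul] at h
      exact ⟨s, hs, dvd_add ((dvd_mul_right _ _).trans h) h'⟩

theorem aux_common (p n : ℕ) [hp : Fact p.Prime]
    (v : R → WithTop ℝ) (hv0 : v 0 = ⊤)
    (hdvd : ∀ x y : R, v y ≤ v x → ∃ z : R, x = y * z) (c : ℝ) {d : ℕ}
    (E : Fin d → TruncatedWittVector p n R) (hE : ∀ i, E i ∈ idealGT p n v c) :
    ∃ t : R, (c : WithTop ℝ) < v t ∧ ∀ i, truncTeichmuller p n t ∣ E i := by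
  choose t ht hdv using fun i => aux_idealGT p n v hv0 hdvd c (hE i)
  have key : ∀ s : Finset (Fin d), ∃ t : R, (c : WithTop ℝ) < v t ∧
      ∀ i ∈ s, truncTeichmuller p n t ∣ E i := by
    intro s
    induction s using Finset.induction_on with
    | empty => exact ⟨0, by simp [hv0], by simp⟩
    | insert a s _ ih =>
      obtain ⟨q, hq, h⟩ := ih
      rcases le_total (v q) (v (t a)) with hle | hle
      · obtain ⟨z, hz⟩ := hdvd _ _ hle
        have h' := hdv a
        rw [hz, aux_teich_mul] at h'
        refine ⟨q, hq, fun i hi => ?_⟩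
        rcases Finset.mem_insert.1 hi with rfl | hi
        · exact (dvd_mul_right _ _).trans h'
        · exact h i hi
      · obtain ⟨z, rfl⟩ := hdvd _ _ hle
        refine ⟨t a, ht a, fun i hi => ?_⟩
        rcases Finset.mem_insert.1 hi with rfl | hi
        · exact hdv _
        · have h' := h i hi
          rw [aux_teich_mul] at h'
          exact (dvd_mul_right _ _).trans h'
  obtain ⟨q, hq, h⟩ := key Finset.univ
  exact ⟨q, hq, fun i => h i (Finset.mem_univ i)⟩

theorem aux_v_pow {v : R → WithTop ℝ} (hvmul : ∀ x y : R, v (x * y) = v x + v y)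
    {x : R} {c : ℝ} (hx : v x = c) {k : ℕ} (hk : 1 ≤ k) :
    v (x ^ k) = ((k * c : ℝ) : WithTop ℝ) := by
  induction k, hk using Nat.le_induction with
  | base => simp [hx]
  | succ k _ ih =>
    rw [pow_succ, hvmul, ih, hx, ← WithTop.coe_add]
    congr 1; push_cast; ring

/-- Right inverse up to a cancellable scalar is a left inverse up to it. -/
theorem aux_comm {S : Type*} [CommRing S] {d : ℕ} (A B : Matrix (Fin d) (Fin d) S) (q : S)
    (hq : ∀ x, q * x = 0 → x = 0) (h : A * B = q • (1 : Matrix (Fin d) (Fin d) S)) :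
    B * A = q • (1 : Matrix (Fin d) (Fin d) S) := by
  have hqd : ∀ (k : ℕ) x, q ^ k * x = 0 → x = 0 := by
    intro k
    induction k with
    | zero => intro x hx; simpa using hx
    | succ k ih => intro x hx; rw [pow_succ', mul_assoc] at hx; exact ih _ (hq _ hx)
  have hdet : A.det * B.det = q ^ d := by
    rw [← Matrix.det_mul, h, Matrix.det_smul]; simp
  have h1 : A * (B * A - q • (1 : Matrix (Fin d) (Fin d) S)) = 0 := by
    rw [mul_sub, ← mul_assoc, h]; simp
  have h2 : A.det • (B * A - q • (1 : Matrix (Fin d) (Fin d) S)) = 0 := by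
    have := congrArg (A.adjugate * ·) h1
    simpa [← mul_assoc, Matrix.adjugate_mul] using this
  rw [← sub_eq_zero]
  ext i j
  have h3 := congrFun (congrFun h2 i) j
  rw [Matrix.smul_apply, smul_eq_mul, Matrix.zero_apply] at h3
  apply hqd d
  rw [← hdet, mul_right_comm, h3, zero_mul]

end Aux

theorem exists_lift_of_frobenius_equation
    (p : ℕ) [hp : Fact p.Prime] {R : Type*} [CommRing R] [CharP R p] [PerfectRing R p]
    (v : R → WithTop ℝ)
    (hv0 : v 0 = ⊤)
    (hvmul : ∀ x y : R, v (x * y) = v x + v y)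
    (hvadd : ∀ x y : R, min (v x) (v y) ≤ v (x + y))
    (hvnonneg : ∀ x : R, 0 ≤ v x)
    (hvtop : ∀ x : R, v x = ⊤ → x = 0)
    -- `R` is complete: every `v`-Cauchy sequence converges
    (hcomplete : ∀ u : ℕ → R,
      (∀ c : ℝ, ∃ K : ℕ, ∀ i ≥ K, ∀ j ≥ K, (c : WithTop ℝ) < v (u i - u j)) →
      ∃ L : R, ∀ c : ℝ, ∃ K : ℕ, ∀ i ≥ K, (c : WithTop ℝ) < v (u i - L))
    -- valuation-ring divisibility property
    (hdvd : ∀ x y : R, v y ≤ v x → ∃ z : R, x = y * z)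
    (n N d : ℕ) (hn : 1 ≤ n) (hN : 1 ≤ N) (hd : 1 ≤ d)
    (ϖ : R) (w : ℝ) (hw : v ϖ = (w : ℝ)) (hw0 : 0 < w)
    (b a : ℝ) (hb : b = N * w / (p - 1)) (ha : a = p * N * w / (p - 1))
    (A B : Matrix (Fin d) (Fin d) (TruncatedWittVector p n R))
    (hAB : A * B = truncTeichmuller p n ϖ ^ N • (1 : Matrix (Fin d) (Fin d) (TruncatedWittVector p n R)))
    (X : Fin d → TruncatedWittVector p n R)
    (hX : ∀ i : Fin d, truncFrobenius p n (X i) - Matrix.vecMul X A i ∈ idealGT p n v a) :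
    ∃ Y : Fin d → TruncatedWittVector p n R,
      (∀ i : Fin d, Y i ∈ idealGT p n v b) ∧
      (∀ i : Fin d, truncFrobenius p n ((X + Y) i) = Matrix.vecMul (X + Y) A i) := by
  have hϖ0 : ϖ ≠ 0 := by
    rintro rfl; rw [hv0] at hw; exact WithTop.top_ne_coe hw
  have : Nontrivial R := ⟨ϖ, 0, hϖ0⟩
  have : NoZeroDivisors R := ⟨fun {x y} hxy => by
    have h := hvmul x y
    rw [hxy, hv0] at h
    rcases WithTop.add_eq_top.1 h.symm with h | h
    · exact Or.inl (hvtop _ h)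
    · exact Or.inr (hvtop _ h)⟩
  have : IsDomain R := NoZeroDivisors.to_isDomain R
  have hp2 : 2 ≤ p := hp.out.two_le
  have hp1 : (0 : ℝ) < (p : ℝ) - 1 := by
    have : (2 : ℝ) ≤ p := by exact_mod_cast hp2
    linarith
  have hNw : (0 : ℝ) < N * w := by
    have : (1 : ℝ) ≤ N := by exact_mod_cast hN
    positivity
  have hab : a = b + N * w := by rw [ha, hb]; field_simp; ring
  have hbp : (p - 1) * b = N * w := by rw [hb]; field_simp
  have hb0 : 0 < b := by rw [hb]; positivity
  have hvN : v (ϖ ^ N) = ((N * w : ℝ) : WithTop ℝ) := aux_v_pow hvmul hw hN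
  -- factor the error term
  obtain ⟨t, ht, htE⟩ := aux_common p n v hv0 hdvd a _ hX
  choose E' hE' using htE
  obtain ⟨s, rfl⟩ := hdvd t (ϖ ^ N) (by
    rw [hvN]; refine le_trans ?_ ht.le; rw [WithTop.coe_le_coe]; linarith)
  have hs : (b : WithTop ℝ) < v s := by
    rw [hvmul, hvN, hab] at ht
    rcases eq_or_ne (v s) ⊤ with h | h
    · rw [h]; exact WithTop.coe_lt_top b
    · obtain ⟨c, hc⟩ := WithTop.ne_top_iff_exists.1 h
      rw [← hc, ← WithTop.coe_add, WithTop.coe_lt_coe] at ht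
      rw [← hc, WithTop.coe_lt_coe]; linarith
  have hr : ∃ r : R, s ^ (p - 1) = ϖ ^ N * r ∧ ∃ ρ : ℝ, 0 < ρ ∧ (ρ : WithTop ℝ) ≤ v r := by
    rcases eq_or_ne (v s) ⊤ with h | h
    · refine ⟨0, ?_, 1, one_pos, by simp [hv0]⟩
      rw [hvtop s h, zero_pow (by omega), mul_zero]
    · obtain ⟨c, hc⟩ := WithTop.ne_top_iff_exists.1 h
      rw [← hc, WithTop.coe_lt_coe] at hs
      have h1 := aux_v_pow hvmul hc.symm (k := p - 1) (by omega)
      rw [Nat.cast_sub (by omega), Nat.cast_one] at h1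
      have h2 : N * w < (p - 1) * c := by rw [← hbp]; exact mul_lt_mul_of_pos_left hs hp1
      obtain ⟨r, hr⟩ := hdvd (s ^ (p - 1)) (ϖ ^ N) (by
        rw [h1, hvN, WithTop.coe_le_coe]; exact h2.le)
      refine ⟨r, hr, (p - 1) * c - N * w, by linarith, ?_⟩
      rw [hr, hvmul, hvN] at h1
      rcases eq_or_ne (v r) ⊤ with h' | h'
      · rw [h']; exact le_top
      · obtain ⟨e, he⟩ := WithTop.ne_top_iff_exists.1 h'
        rw [← he, ← WithTop.coe_add, WithTop.coe_inj] at h1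
        rw [← he, WithTop.coe_le_coe]; linarith
  obtain ⟨r, hsr, ρ, hρ, hρr⟩ := hr
  have hres := fun (B : Fin d → Fin d → R) (C : Fin d → R) =>
    aux_residue p v hv0 hvmul hvadd hvnonneg hvtop hcomplete r ρ hρ hρr B C
  obtain ⟨Z, hZ⟩ := aux_solve p n r hres B (Matrix.vecMul E' B)
  set q := truncTeichmuller p n (ϖ ^ N) with hq
  have hqc : ∀ x, q * x = 0 → x = 0 := aux_cancel p n _ (pow_ne_zero N hϖ0)
  rw [← aux_teich_pow, ← hq] at hAB
  have hBA := aux_comm A B q hqc hAB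
  set σ := truncTeichmuller p n s with hσ
  set τ := truncTeichmuller p n r with hτ
  have hσp : truncTeichmuller p n (s ^ p) = σ * (q * τ) := by
    rw [hσ, hq, hτ, ← aux_teich_mul, ← aux_teich_mul, ← hsr, ← pow_succ',
      Nat.sub_add_cancel (by omega)]
  have hZA : Matrix.vecMul Z A
      = q • (τ • (fun j => truncFrobenius p n (Z j)) + E') := by
    conv_lhs => rw [hZ]
    rw [Matrix.add_vecMul, Matrix.smul_vecMul, Matrix.vecMul_vecMul, Matrix.vecMul_vecMul, hBA,
      Matrix.vecMul_smul, Matrix.vecMul_smul, Matrix.vecMul_one, Matrix.vecMul_one, smul_add,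
      smul_comm τ q]
  refine ⟨σ • Z, fun i => ?_, fun i => ?_⟩
  · exact Ideal.mul_mem_right _ _ (Ideal.subset_span ⟨s, hs, rfl⟩)
  · have h1 : Matrix.vecMul (σ • Z) A i = σ * (q * (τ * truncFrobenius p n (Z i) + E' i)) := by
      rw [Matrix.smul_vecMul, hZA]; rfl
    have h2 : truncFrobenius p n ((σ • Z) i) = σ * (q * τ) * truncFrobenius p n (Z i) := by
      rw [← hσp, ← aux_truncFrob_teich, ← aux_truncFrob_mul]; rfl
    have h3 := hE' i
    rw [aux_teich_mul, ← hq, ← hσ] at h3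
    rw [Matrix.add_vecMul, Pi.add_apply, Pi.add_apply, aux_truncFrob_add, h1, h2]
    linear_combination h3
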